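/- arXiv:2005.07275 — 2 statements merged into one kernel-verified Lean document; each statement's English description precedes it below -/
import Mathlib

section
/- For p = c·exp(-φ) ∈ B² with Gaussian measure ν = N(μ, Σ), Σ = LLᵀ, the quadratic-block projection coefficients satisfy α₂ = ⟨g₂, p⟩ = √((1/2)DᵀD)·vech(Lᵀ·E_ν[∂²φ/∂xᵀ∂x]·L), and consequently α₂ᵀγ₂(x) = (1/2)(x−μ)ᵀ E_ν[∂²φ/∂xᵀ∂x] (x−μ). -/
open MeasureTheory Real Matrix

noncomputable section

/-- The Bayes-space inner product `⟨p₁,p₂⟩ = E_ν[ln p₁ ln p₂] − E_ν[ln p₁]E_ν[ln p₂]`. -/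
def bip {X : Type*} [MeasurableSpace X] (ν : Measure X) (p q : X → ℝ) : ℝ :=
  (∫ x, Real.log (p x) * Real.log (q x) ∂ν) -
    (∫ x, Real.log (p x) ∂ν) * (∫ x, Real.log (q x) ∂ν)

/-- The Gaussian measure `N(μ, Σ)` on `ℝᴺ`, given by its density w.r.t. Lebesgue measure. -/
def gaussPi (N : ℕ) (μ : Fin N → ℝ) (S : Matrix (Fin N) (Fin N) ℝ) : Measure (Fin N → ℝ) :=
  volume.withDensity fun x => ENNReal.ofReal
    ((Real.sqrt ((2 * π) ^ N * S.det))⁻¹ *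
      Real.exp (-(1 / 2) * ((x - μ) ⬝ᵥ S⁻¹.mulVec (x - μ))))

/-- First block of the orthonormal indefinite-Gaussian basis:
`g₁ᵢ(x) = exp (-(L⁻¹(x−μ))ᵢ)`. -/
def gOne (N : ℕ) (μ : Fin N → ℝ) (L : Matrix (Fin N) (Fin N) ℝ) (i : Fin N) :
    (Fin N → ℝ) → ℝ :=
  fun x => Real.exp (-(L⁻¹.mulVec (x - μ)) i)

/-- Second block of the orthonormal indefinite-Gaussian basis:
`g₂ₖ(x) = exp (-(√((1/2)DᵀD)·vech (L⁻¹(x−μ)(x−μ)ᵀL⁻ᵀ))ₖ)`, where `R = √((1/2)DᵀD)` and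
`vech` is the half-vectorization. -/
def gTwo (N M : ℕ) (μ : Fin N → ℝ) (L : Matrix (Fin N) (Fin N) ℝ)
    (vech : Matrix (Fin N) (Fin N) ℝ → Fin M → ℝ) (R : Matrix (Fin M) (Fin M) ℝ)
    (k : Fin M) : (Fin N → ℝ) → ℝ :=
  fun x => Real.exp (-(R.mulVec (vech (L⁻¹ * vecMulVec (x - μ) (x - μ) * (L⁻¹)ᵀ))) k)

/-- A duplication matrix `D` with `M = N(N+1)/2` columns has trivial kernel, because its range
contains the vectorizations of all symmetric matrices. -/
lemma duplication_mulVec_injective {N M : ℕ} (hM : M = N * (N + 1) / 2)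
    {vech : Matrix (Fin N) (Fin N) ℝ → Fin M → ℝ} {D : Matrix (Fin N × Fin N) (Fin M) ℝ}
    (hD : ∀ A : Matrix (Fin N) (Fin N) ℝ, A.IsSymm →
      ∀ ij : Fin N × Fin N, (D.mulVec (vech A)) ij = A ij.1 ij.2) :
    Function.Injective D.mulVec := by
  let T : (Fin M → ℝ) →ₗ[ℝ] (Sym2 (Fin N) → ℝ) :=
    (LinearMap.funLeft ℝ ℝ (fun s : Sym2 (Fin N) => s.out)) ∘ₗ D.mulVecLin
  have hT : Function.Surjective T := fun f => by
    refine ⟨vech (Matrix.of fun i j => f s(i, j)), ?_⟩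
    ext s
    have := hD (Matrix.of fun i j => f s(i, j)) (by ext i j; simp [Sym2.eq_swap]) s.out
    simp only [T, LinearMap.comp_apply, LinearMap.funLeft_apply, Matrix.mulVecLin_apply, this,
      Matrix.of_apply]
    congr 1
    exact s.out_eq
  have hcard : Module.finrank ℝ (Fin M → ℝ) = Module.finrank ℝ (Sym2 (Fin N) → ℝ) := by
    simp [Sym2.card, Nat.choose_two_right, hM, mul_comm]
  have hinj := (LinearMap.injective_iff_surjective_of_finrank_eq_finrank hcard).2 hT
  intro u v huv
  apply hinj
  simp only [T, LinearMap.comp_apply, Matrix.mulVecLin_apply, huv]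

lemma Matrix.exists_mul_eq_one_of_mulVec_injective {m n : Type*} [Fintype m] [Fintype n]
    [DecidableEq n] {A : Matrix m n ℝ} (hA : Function.Injective A.mulVec) :
    ∃ P : Matrix n m ℝ, P * A = 1 := by
  classical
  obtain ⟨g, hg⟩ := (Matrix.toLin' A).exists_leftInverse_of_injective (LinearMap.ker_eq_bot.2 hA)
  refine ⟨LinearMap.toMatrix' g, ?_⟩
  have := congrArg LinearMap.toMatrix' hg
  simpa [LinearMap.toMatrix'_comp] using this

/-- The weighted half-vectorization `R · vech A` and the entries of a symmetric matrix `A` are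
linear functions of each other. -/
lemma weighted_vech_linear {N M : ℕ} (hM : M = N * (N + 1) / 2)
    {vech : Matrix (Fin N) (Fin N) ℝ → Fin M → ℝ} {D : Matrix (Fin N × Fin N) (Fin M) ℝ}
    (hD : ∀ A : Matrix (Fin N) (Fin N) ℝ, A.IsSymm →
      ∀ ij : Fin N × Fin N, (D.mulVec (vech A)) ij = A ij.1 ij.2)
    {R : Matrix (Fin M) (Fin M) ℝ} (hR : R * R = (2⁻¹ : ℝ) • (Dᵀ * D)) :
    ∃ (Q : Matrix (Fin M) (Fin N × Fin N) ℝ) (T : Matrix (Fin N × Fin N) (Fin M) ℝ),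
      ∀ A : Matrix (Fin N) (Fin N) ℝ, A.IsSymm →
        (∀ k, R.mulVec (vech A) k = ∑ ij, Q k ij * A ij.1 ij.2) ∧
        ∀ ij : Fin N × Fin N, A ij.1 ij.2 = ∑ k, T ij k * R.mulVec (vech A) k := by
  have hDi := duplication_mulVec_injective hM hD
  have hRi : Function.Injective R.mulVec := by
    rw [← Matrix.coe_mulVecLin, ← LinearMap.ker_eq_bot, LinearMap.ker_eq_bot']
    intro v hv
    rw [Matrix.mulVecLin_apply] at hv
    have h1 : (Dᵀ * D) *ᵥ v = 0 := by
      have : (R * R) *ᵥ v = 0 := by rw [← Matrix.mulVec_mulVec, hv, Matrix.mulVec_zero]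
      rw [hR, Matrix.smul_mulVec] at this
      simpa using this
    have h2 : D *ᵥ v = 0 := by
      rw [← dotProduct_self_eq_zero, Matrix.dotProduct_mulVec, ← Matrix.mulVec_transpose,
        Matrix.mulVec_mulVec, h1, zero_dotProduct]
    exact hDi (by rw [h2, Matrix.mulVec_zero])
  obtain ⟨P, hP⟩ := Matrix.exists_mul_eq_one_of_mulVec_injective hDi
  obtain ⟨S, hS⟩ := Matrix.exists_mul_eq_one_of_mulVec_injective hRi
  refine ⟨R * P, D * S, fun A hA => ?_⟩
  have hDA : D *ᵥ vech A = fun ij => A ij.1 ij.2 := funext (hD A hA)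
  constructor
  · intro k
    have : R *ᵥ vech A = (R * P) *ᵥ fun ij => A ij.1 ij.2 := by
      rw [← hDA, Matrix.mulVec_mulVec, Matrix.mul_assoc, hP, Matrix.mul_one]
    rw [this]; rfl
  · intro ij
    have : (D * S) *ᵥ (R *ᵥ vech A) = fun ij => A ij.1 ij.2 := by
      rw [← hDA, Matrix.mulVec_mulVec, Matrix.mul_assoc, hS, Matrix.mul_one]
    exact (congrFun this ij).symm

lemma weighted_vech_dotProduct {N M : ℕ}
    {vech : Matrix (Fin N) (Fin N) ℝ → Fin M → ℝ} {D : Matrix (Fin N × Fin N) (Fin M) ℝ}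
    (hD : ∀ A : Matrix (Fin N) (Fin N) ℝ, A.IsSymm →
      ∀ ij : Fin N × Fin N, (D.mulVec (vech A)) ij = A ij.1 ij.2)
    {R : Matrix (Fin M) (Fin M) ℝ} (hR : R * R = (2⁻¹ : ℝ) • (Dᵀ * D)) (hRs : R.IsSymm)
    {A B : Matrix (Fin N) (Fin N) ℝ} (hA : A.IsSymm) (hB : B.IsSymm) :
    R.mulVec (vech A) ⬝ᵥ R.mulVec (vech B) = 2⁻¹ * ∑ i, ∑ j, A i j * B i j := by
  rw [Matrix.dotProduct_mulVec, ← Matrix.mulVec_transpose, hRs.eq, Matrix.mulVec_mulVec, hR,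
    Matrix.smul_mulVec, smul_dotProduct, ← Matrix.mulVec_mulVec, Matrix.mulVec_transpose,
    ← Matrix.dotProduct_mulVec, smul_eq_mul, dotProduct, Fintype.sum_prod_type]
  simp_rw [hD A hA, hD B hB]

lemma mul_vecMulVec_mul_transpose {m n : Type*} [Fintype n] (A : Matrix m n ℝ) (v : n → ℝ) :
    A * vecMulVec v v * Aᵀ = vecMulVec (A *ᵥ v) (A *ᵥ v) := by
  rw [Matrix.mul_vecMulVec, Matrix.vecMulVec_mul, Matrix.vecMul_transpose]

lemma isSymm_vecMulVec_self {n : Type*} (v : n → ℝ) : (vecMulVec v v).IsSymm := by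
  ext i j
  simp [vecMulVec_apply, mul_comm]

lemma sum_mul_vecMulVec {n : Type*} [Fintype n] (A : Matrix n n ℝ) (v : n → ℝ) :
    ∑ i, ∑ j, A i j * vecMulVec v v i j = v ⬝ᵥ A *ᵥ v := by
  simp only [dotProduct, mulVec, vecMulVec_apply, Finset.mul_sum]
  exact Finset.sum_congr rfl fun i _ => Finset.sum_congr rfl fun j _ => by ring

/-- Second-order integration by parts against a compactly supported function. -/
lemma integral_fderiv_fderiv_mul_eq {E : Type*} [NormedAddCommGroup E] [NormedSpace ℝ E]
    [FiniteDimensional ℝ E] [MeasurableSpace E] [BorelSpace E] (m : Measure E) [m.IsAddHaarMeasure]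
    {f G : E → ℝ} (hf : ContDiff ℝ 2 f) (hG : ContDiff ℝ 2 G) (hGc : HasCompactSupport G)
    (u v : E) :
    ∫ x, fderiv ℝ (fun y => fderiv ℝ f y v) x u * G x ∂m =
      ∫ x, f x * fderiv ℝ (fun y => fderiv ℝ G y u) x v ∂m := by
  have hder : ∀ {F : E → ℝ}, ContDiff ℝ 2 F → ∀ w, ContDiff ℝ 1 fun y => fderiv ℝ F y w :=
    fun hF w => (hF.fderiv_right (m := 1) (by norm_num)).clm_apply contDiff_const
  have hcont : ∀ {F : E → ℝ}, ContDiff ℝ 1 F → ∀ w, Continuous fun y => fderiv ℝ F y w :=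
    fun hF w => (hF.continuous_fderiv one_ne_zero).clm_apply continuous_const
  have hG1 := hGc.fderiv_apply (𝕜 := ℝ) u
  have hG2 := hG1.fderiv_apply (𝕜 := ℝ) v
  have key : ∀ {F H : E → ℝ}, ContDiff ℝ 1 F → ContDiff ℝ 1 H → HasCompactSupport H → ∀ w,
      ∫ x, fderiv ℝ F x w * H x ∂m = - ∫ x, F x * fderiv ℝ H x w ∂m := by
    intro F H hF hH hHc w
    rw [integral_mul_fderiv_eq_neg_fderiv_mul_of_integrable, neg_neg]
    · exact ((hcont hF w).mul hH.continuous).integrable_of_hasCompactSupport hHc.mul_left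
    · exact (hF.continuous.mul (hcont hH w)).integrable_of_hasCompactSupport
        (hHc.fderiv_apply (𝕜 := ℝ) w).mul_left
    · exact (hF.continuous.mul hH.continuous).integrable_of_hasCompactSupport hHc.mul_left
    · exact fun x _ => hF.differentiable one_ne_zero x
    · exact fun x _ => hH.differentiable one_ne_zero x
  rw [key (hder hf v) (hG.of_le (by norm_num)) hGc u,
    key (hf.of_le (by norm_num)) (hder hG u) hG1 v, neg_neg]

/-- A `C²` cutoff on `ℝ` equal to one at the origin, with bounded derivatives. -/
lemma exists_cutoff : ∃ (h : ℝ → ℝ) (B : ℝ), ContDiff ℝ 2 h ∧ h 0 = 1 ∧ (∀ t, 2 ≤ t → h t = 0) ∧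
    (∀ t, |h t| ≤ B) ∧ (∀ t, |deriv h t| ≤ B) ∧ ∀ t, |deriv (deriv h) t| ≤ B := by
  let f : ContDiffBump (0 : ℝ) := ⟨1, 2, one_pos, one_lt_two⟩
  have hf : ContDiff ℝ 2 f := f.contDiff
  have hf1 : ContDiff ℝ 1 (deriv f) := hf.deriv' (n := 1)
  obtain ⟨B0, h0⟩ := f.hasCompactSupport.exists_bound_of_continuous hf.continuous
  obtain ⟨B1, h1⟩ := f.hasCompactSupport.deriv.exists_bound_of_continuous hf1.continuous
  obtain ⟨B2, h2⟩ := f.hasCompactSupport.deriv.deriv.exists_bound_of_continuous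
    (hf1.continuous_deriv le_rfl)
  refine ⟨f, max B0 (max B1 B2), hf, ?_, fun t ht => ?_, fun t => ?_, fun t => ?_, fun t => ?_⟩
  · exact f.eventuallyEq_one.self_of_nhds
  · exact f.zero_of_le_dist (by simpa [f] using ht.trans (le_abs_self t))
  · exact (h0 t).trans (le_max_left _ _)
  · exact (h1 t).trans ((le_max_left _ _).trans (le_max_right _ _))
  · exact (h2 t).trans ((le_max_right _ _).trans (le_max_right _ _))

section Whitening

variable {N : ℕ} (μ : Fin N → ℝ) (L : Matrix (Fin N) (Fin N) ℝ)

/-- The whitening map `x ↦ L⁻¹(x − μ)`. -/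
def whiten (x : Fin N → ℝ) : Fin N → ℝ := L⁻¹ *ᵥ (x - μ)

variable {L}

lemma hasFDerivAt_whiten (x : Fin N → ℝ) :
    HasFDerivAt (whiten μ L) (L⁻¹.mulVecLin.toContinuousLinearMap) x := by
  have h := (L⁻¹.mulVecLin.toContinuousLinearMap.hasFDerivAt (x := x - μ)).comp x
    ((hasFDerivAt_id x).sub_const μ)
  rwa [ContinuousLinearMap.comp_id] at h

lemma contDiff_whiten {n : WithTop ℕ∞} : ContDiff ℝ n (whiten μ L) :=
  (L⁻¹.mulVecLin.toContinuousLinearMap.contDiff).comp (contDiff_id.sub contDiff_const)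

lemma hasFDerivAt_whiten_apply (x : Fin N → ℝ) (a : Fin N) :
    HasFDerivAt (fun y => whiten μ L y a)
      ((ContinuousLinearMap.proj a).comp (L⁻¹.mulVecLin.toContinuousLinearMap)) x :=
  (ContinuousLinearMap.proj (R := ℝ) (φ := fun _ : Fin N => ℝ) a).hasFDerivAt.comp x
    (hasFDerivAt_whiten μ x)

lemma contDiff_whiten_dot {n : WithTop ℕ∞} :
    ContDiff ℝ n fun y => whiten μ L y ⬝ᵥ whiten μ L y := by
  have := contDiff_pi.1 (contDiff_whiten (L := L) (n := n) μ)
  exact ContDiff.sum fun i _ => (this i).mul (this i)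

lemma hasFDerivAt_whiten_dot (x : Fin N → ℝ) :
    HasFDerivAt (fun y => whiten μ L y ⬝ᵥ whiten μ L y)
      (∑ i, (2 * whiten μ L x i) •
        (ContinuousLinearMap.proj i).comp (L⁻¹.mulVecLin.toContinuousLinearMap)) x := by
  refine (HasFDerivAt.fun_sum fun i _ => (hasFDerivAt_whiten_apply (L := L) μ x i).mul
    (hasFDerivAt_whiten_apply μ x i)).congr_fderiv ?_
  refine Finset.sum_congr rfl fun i _ => ?_
  rw [← add_smul, two_mul]

variable (hL : IsUnit L.det)
include hL

lemma inv_mulVec_mulVec_single (a : Fin N) :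
    L⁻¹ *ᵥ (L *ᵥ Pi.single a 1) = Pi.single a 1 := by
  rw [Matrix.mulVec_mulVec, Matrix.nonsing_inv_mul L hL, Matrix.one_mulVec]

lemma fderiv_whiten_apply_mulVec_single (x : Fin N → ℝ) (a b : Fin N) :
    fderiv ℝ (fun y => whiten μ L y a) x (L *ᵥ Pi.single b 1) = if a = b then 1 else 0 := by
  rw [(hasFDerivAt_whiten_apply μ x a).fderiv]
  change (L⁻¹ *ᵥ (L *ᵥ Pi.single b 1)) a = _
  rw [inv_mulVec_mulVec_single hL, Pi.single_apply]

lemma fderiv_whiten_dot_mulVec_single (x : Fin N → ℝ) (a : Fin N) :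
    fderiv ℝ (fun y => whiten μ L y ⬝ᵥ whiten μ L y) x (L *ᵥ Pi.single a 1) =
      2 * whiten μ L x a := by
  rw [(hasFDerivAt_whiten_dot μ x).fderiv, _root_.sum_apply]
  change ∑ i, (2 * whiten μ L x i) * (L⁻¹ *ᵥ (L *ᵥ Pi.single a 1)) i = _
  rw [inv_mulVec_mulVec_single hL]
  simp [Pi.single_apply]

lemma fderiv_comp_whiten_dot {k : ℝ → ℝ} (hk : Differentiable ℝ k) (x : Fin N → ℝ) (a : Fin N) :
    fderiv ℝ (fun y => k (whiten μ L y ⬝ᵥ whiten μ L y)) x (L *ᵥ Pi.single a 1) =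
      2 * deriv k (whiten μ L x ⬝ᵥ whiten μ L x) * whiten μ L x a := by
  have h := (hk (whiten μ L x ⬝ᵥ whiten μ L x)).hasDerivAt.comp_hasFDerivAt x
    (hasFDerivAt_whiten_dot (L := L) μ x)
  change HasFDerivAt (fun y => k (whiten μ L y ⬝ᵥ whiten μ L y)) _ x at h
  have h2 := fderiv_whiten_dot_mulVec_single μ hL x a
  rw [(hasFDerivAt_whiten_dot μ x).fderiv] at h2
  rw [h.fderiv, _root_.smul_apply, h2, smul_eq_mul]
  ring

lemma fderiv_fderiv_comp_whiten_dot {k : ℝ → ℝ} (hk : ContDiff ℝ 2 k) (x : Fin N → ℝ)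
    (a b : Fin N) :
    fderiv ℝ (fun y => fderiv ℝ (fun y => k (whiten μ L y ⬝ᵥ whiten μ L y)) y
        (L *ᵥ Pi.single a 1)) x (L *ᵥ Pi.single b 1) =
      4 * deriv (deriv k) (whiten μ L x ⬝ᵥ whiten μ L x) * (whiten μ L x a * whiten μ L x b) +
        2 * deriv k (whiten μ L x ⬝ᵥ whiten μ L x) * (if a = b then 1 else 0) := by
  have hk1 : ContDiff ℝ 1 (deriv k) := hk.deriv' (n := 1)
  have hd : Differentiable ℝ fun y => deriv k (whiten μ L y ⬝ᵥ whiten μ L y) :=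
    (hk1.comp (contDiff_whiten_dot μ)).differentiable one_ne_zero
  simp_rw [fderiv_comp_whiten_dot μ hL (hk.differentiable two_ne_zero), mul_assoc]
  rw [fderiv_const_mul ((hd x).fun_mul (hasFDerivAt_whiten_apply μ x a).differentiableAt),
    fderiv_fun_mul (hd x) (hasFDerivAt_whiten_apply μ x a).differentiableAt]
  simp only [_root_.smul_apply, _root_.add_apply, smul_eq_mul,
    fderiv_comp_whiten_dot μ hL (hk1.differentiable one_ne_zero),
    fderiv_whiten_apply_mulVec_single μ hL]
  ring

lemma hasCompactSupport_comp_whiten_dot {k : ℝ → ℝ} {c : ℝ} (hk : ∀ t, c ≤ t → k t = 0) :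
    HasCompactSupport fun y => k (whiten μ L y ⬝ᵥ whiten μ L y) := by
  refine HasCompactSupport.intro (K := (fun z => L *ᵥ z + μ) '' Metric.closedBall 0 (1 + |c|))
    ((isCompact_closedBall _ _).image ?_) fun x hx => hk _ ?_
  · exact (Continuous.matrix_mulVec continuous_const continuous_id).add continuous_const
  · by_contra! hlt
    refine hx ⟨whiten μ L x, ?_, ?_⟩
    · rw [mem_closedBall_zero_iff, pi_norm_le_iff_of_nonneg (by positivity)]
      intro i
      have h1 : whiten μ L x i ^ 2 ≤ whiten μ L x ⬝ᵥ whiten μ L x := by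
        simp only [dotProduct, ← sq]
        exact Finset.single_le_sum (f := fun i => whiten μ L x i ^ 2)
          (fun i _ => sq_nonneg _) (Finset.mem_univ i)
      have h2 := le_abs_self c
      have h3 := abs_nonneg c
      rw [Real.norm_eq_abs]
      refine abs_le_of_sq_le_sq ?_ (by positivity)
      nlinarith
    · simp [whiten, Matrix.mulVec_mulVec, Matrix.mul_nonsing_inv L hL]

/-- Stein's identity of second order for the unnormalized Gaussian weight. No integrability of the
first derivative of `f` is needed. -/
lemma integral_stein_weight {f : (Fin N → ℝ) → ℝ} (hf : ContDiff ℝ 2 f) (a b : Fin N)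
    (h0 : Integrable fun x => Real.exp (-(1 / 2) * (whiten μ L x ⬝ᵥ whiten μ L x)) * f x)
    (h1 : Integrable fun x => Real.exp (-(1 / 2) * (whiten μ L x ⬝ᵥ whiten μ L x)) *
      (whiten μ L x a * whiten μ L x b * f x))
    (h2 : Integrable fun x => Real.exp (-(1 / 2) * (whiten μ L x ⬝ᵥ whiten μ L x)) *
      fderiv ℝ (fun y => fderiv ℝ f y (L *ᵥ Pi.single b 1)) x (L *ᵥ Pi.single a 1)) :
    ∫ x, Real.exp (-(1 / 2) * (whiten μ L x ⬝ᵥ whiten μ L x)) *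
        fderiv ℝ (fun y => fderiv ℝ f y (L *ᵥ Pi.single b 1)) x (L *ᵥ Pi.single a 1) =
      (∫ x, Real.exp (-(1 / 2) * (whiten μ L x ⬝ᵥ whiten μ L x)) *
        (whiten μ L x a * whiten μ L x b * f x)) -
      (if a = b then 1 else 0) *
        ∫ x, Real.exp (-(1 / 2) * (whiten μ L x ⬝ᵥ whiten μ L x)) * f x := by
  obtain ⟨h, B, hh, hh0, hh2, hB0, hB1, hB2⟩ := exists_cutoff
  have hhd : ContDiff ℝ 1 (deriv h) := hh.deriv' (n := 1)
  have hhc0 := hh.continuous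
  have hhc1 := hhd.continuous
  have hhc2 := hhd.continuous_deriv le_rfl
  let q : (Fin N → ℝ) → ℝ := fun x => whiten μ L x ⬝ᵥ whiten μ L x
  have hqc : Continuous q := (contDiff_whiten_dot (n := 0) μ).continuous
  let δ : ℝ := if a = b then 1 else 0
  have hδ : |δ| ≤ 1 := by simp only [δ]; split_ifs <;> simp
  let F : (Fin N → ℝ) → ℝ := fun x =>
    fderiv ℝ (fun y => fderiv ℝ f y (L *ᵥ Pi.single b 1)) x (L *ᵥ Pi.single a 1)
  let r : ℕ → ℝ := fun n => 1 / ((n : ℝ) + 1)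
  have hr0 : ∀ n, 0 < r n := fun n => by positivity
  have hr1 : ∀ n, r n ≤ 1 := fun n => by
    simp only [r]
    rw [div_le_one (by positivity)]
    simp
  have hr : Filter.Tendsto r Filter.atTop (nhds 0) := tendsto_one_div_add_atTop_nhds_zero_nat
  let k : ℕ → ℝ → ℝ := fun n t => h (r n * t) * Real.exp (-(1 / 2) * t)
  have hk : ∀ n, ContDiff ℝ 2 (k n) := fun n =>
    (hh.comp (contDiff_const.mul contDiff_id)).mul (contDiff_const.mul contDiff_id).exp
  have hmul : ∀ (s t : ℝ), HasDerivAt (fun t => s * t) s t := fun s t => by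
    simpa using (hasDerivAt_id t).const_mul s
  have hk1 : ∀ n, deriv (k n) =
      fun t => (r n * deriv h (r n * t) - 1 / 2 * h (r n * t)) * Real.exp (-(1 / 2) * t) := by
    intro n
    ext t
    have d0 : HasDerivAt (fun t => h (r n * t)) (deriv h (r n * t) * r n) t :=
      ((hh.differentiable two_ne_zero) _).hasDerivAt.comp t (hmul _ t)
    refine (d0.fun_mul (hmul (-(1 / 2)) t).exp).deriv.trans ?_
    ring
  have hk2 : ∀ n t, deriv (deriv (k n)) t =
      (r n ^ 2 * deriv (deriv h) (r n * t) - r n * deriv h (r n * t) + 1 / 4 * h (r n * t)) *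
        Real.exp (-(1 / 2) * t) := by
    intro n t
    have d0 : HasDerivAt (fun t => h (r n * t)) (deriv h (r n * t) * r n) t :=
      ((hh.differentiable two_ne_zero) _).hasDerivAt.comp t (hmul _ t)
    have d1 : HasDerivAt (fun t => deriv h (r n * t)) (deriv (deriv h) (r n * t) * r n) t :=
      ((hhd.differentiable one_ne_zero) _).hasDerivAt.comp t (hmul _ t)
    rw [hk1]
    refine (((d1.const_mul (r n)).fun_sub (d0.const_mul (1 / 2))).fun_mul
      (hmul (-(1 / 2)) t).exp).deriv.trans ?_
    ring
  have hibp : ∀ n, ∫ x, h (r n * q x) * (Real.exp (-(1 / 2) * q x) * F x) =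
      ∫ x, ((4 * r n ^ 2 * deriv (deriv h) (r n * q x) - 4 * r n * deriv h (r n * q x) +
            h (r n * q x)) *
          (Real.exp (-(1 / 2) * q x) * (whiten μ L x a * whiten μ L x b * f x)) +
        (2 * r n * deriv h (r n * q x) - h (r n * q x)) * δ *
          (Real.exp (-(1 / 2) * q x) * f x)) := by
    intro n
    have hsupp : HasCompactSupport fun y => k n (whiten μ L y ⬝ᵥ whiten μ L y) := by
      refine hasCompactSupport_comp_whiten_dot μ hL (c := 2 / r n) fun t ht => ?_
      have : h (r n * t) = 0 := hh2 _ (by rwa [div_le_iff₀' (hr0 n)] at ht)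
      simp [k, this]
    have := integral_fderiv_fderiv_mul_eq volume hf ((hk n).comp (contDiff_whiten_dot μ)) hsupp
      (L *ᵥ Pi.single a 1) (L *ᵥ Pi.single b 1)
    refine Eq.trans (integral_congr_ae (.of_forall fun x => ?_))
      (this.trans (integral_congr_ae (.of_forall fun x => ?_)))
    · simp only [k, q, F, Function.comp_apply]
      ring
    · have e := fderiv_fderiv_comp_whiten_dot μ hL (hk n) x a b
      simp only [Function.comp_def] at e ⊢
      rw [e, hk2, hk1]
      simp only [q, δ]
      ring
  have hrq : ∀ x, Filter.Tendsto (fun n => r n * q x) Filter.atTop (nhds 0) := fun x => by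
    simpa using hr.mul_const (q x)
  have lim0 : ∀ x, Filter.Tendsto (fun n => h (r n * q x)) Filter.atTop (nhds 1) := fun x => by
    have := (hhc0.tendsto 0).comp (hrq x)
    rwa [hh0] at this
  have lim1 : ∀ x, Filter.Tendsto (fun n => deriv h (r n * q x)) Filter.atTop
      (nhds (deriv h 0)) := fun x => (hhc1.tendsto 0).comp (hrq x)
  have lim2 : ∀ x, Filter.Tendsto (fun n => deriv (deriv h) (r n * q x)) Filter.atTop
      (nhds (deriv (deriv h) 0)) := fun x => (hhc2.tendsto 0).comp (hrq x)
  have hmeas : ∀ {g : ℝ → ℝ}, Continuous g → ∀ n, AEStronglyMeasurable (fun x => g (r n * q x))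
      (volume : Measure (Fin N → ℝ)) :=
    fun hg n => (hg.comp (continuous_const.mul hqc)).aestronglyMeasurable
  have tL : Filter.Tendsto (fun n => ∫ x, h (r n * q x) * (Real.exp (-(1 / 2) * q x) * F x))
      Filter.atTop (nhds (∫ x, Real.exp (-(1 / 2) * q x) * F x)) := by
    refine tendsto_integral_of_dominated_convergence
      (fun x => B * ‖Real.exp (-(1 / 2) * q x) * F x‖)
      (fun n => (hmeas hhc0 n).mul h2.aestronglyMeasurable) (h2.norm.const_mul B)
      (fun n => .of_forall fun x => ?_) (.of_forall fun x => ?_)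
    · rw [norm_mul]
      exact mul_le_mul_of_nonneg_right (hB0 _) (norm_nonneg _)
    · simpa using (lim0 x).mul_const (Real.exp (-(1 / 2) * q x) * F x)
  have tR : Filter.Tendsto (fun n =>
      ∫ x, ((4 * r n ^ 2 * deriv (deriv h) (r n * q x) - 4 * r n * deriv h (r n * q x) +
            h (r n * q x)) *
          (Real.exp (-(1 / 2) * q x) * (whiten μ L x a * whiten μ L x b * f x)) +
        (2 * r n * deriv h (r n * q x) - h (r n * q x)) * δ *
          (Real.exp (-(1 / 2) * q x) * f x))) Filter.atTop
      (nhds (∫ x, (Real.exp (-(1 / 2) * q x) * (whiten μ L x a * whiten μ L x b * f x) -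
        δ * (Real.exp (-(1 / 2) * q x) * f x)))) := by
    refine tendsto_integral_of_dominated_convergence
      (fun x => 9 * B *
          ‖Real.exp (-(1 / 2) * q x) * (whiten μ L x a * whiten μ L x b * f x)‖ +
        3 * B * ‖Real.exp (-(1 / 2) * q x) * f x‖)
      (fun n => ?_) ((h1.norm.const_mul _).add (h0.norm.const_mul _))
      (fun n => .of_forall fun x => ?_) (.of_forall fun x => ?_)
    · exact (((((hmeas hhc2 n).const_mul _).sub ((hmeas hhc1 n).const_mul _)).add
        (hmeas hhc0 n)).mul h1.aestronglyMeasurable).add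
        (((((hmeas hhc1 n).const_mul _).sub (hmeas hhc0 n)).mul_const _).mul
          h0.aestronglyMeasurable)
    · have b0 := hB0 (r n * q x)
      have b1 := hB1 (r n * q x)
      have b2 := hB2 (r n * q x)
      have hB : 0 ≤ B := (abs_nonneg _).trans b0
      have c1 : |r n * deriv h (r n * q x)| ≤ B := by
        rw [abs_mul, abs_of_pos (hr0 n)]
        exact (mul_le_mul (hr1 n) b1 (abs_nonneg _) zero_le_one).trans_eq (one_mul B)
      have c2 : |r n ^ 2 * deriv (deriv h) (r n * q x)| ≤ B := by
        rw [abs_mul, abs_of_pos (pow_pos (hr0 n) 2)]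
        exact (mul_le_mul (pow_le_one₀ (hr0 n).le (hr1 n)) b2 (abs_nonneg _)
          zero_le_one).trans_eq (one_mul B)
      refine (norm_add_le _ _).trans (add_le_add ?_ ?_)
      · rw [norm_mul]
        refine mul_le_mul_of_nonneg_right ?_ (norm_nonneg _)
        rw [Real.norm_eq_abs, abs_le]
        rw [abs_le] at b0 c1 c2
        constructor <;> linarith [b0.1, b0.2, c1.1, c1.2, c2.1, c2.2]
      · rw [norm_mul, norm_mul]
        refine mul_le_mul_of_nonneg_right ?_ (norm_nonneg _)
        refine (mul_le_mul (b := 3 * B) ?_ hδ (abs_nonneg _) (by positivity)).trans_eq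
          (mul_one _)
        rw [Real.norm_eq_abs, abs_le]
        rw [abs_le] at b0 c1
        constructor <;> linarith [b0.1, b0.2, c1.1, c1.2]
    · have l1 := (((((hr.pow 2).const_mul 4).mul (lim2 x)).sub
        ((hr.const_mul 4).mul (lim1 x))).add (lim0 x)).mul_const
          (Real.exp (-(1 / 2) * q x) * (whiten μ L x a * whiten μ L x b * f x))
      have l2 := ((((hr.const_mul 2).mul (lim1 x)).sub (lim0 x)).mul_const δ).mul_const
        (Real.exp (-(1 / 2) * q x) * f x)
      convert l1.add l2 using 2
      ring
  have hlim := tendsto_nhds_unique tL (by simpa only [hibp] using tR)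
  rw [integral_sub h1 (h0.const_mul _), integral_const_mul] at hlim
  exact hlim

lemma map_whiten_volume :
    Measure.map (whiten μ L) volume = ENNReal.ofReal |L.det| • volume := by
  have h : whiten μ L = toLin' L⁻¹ ∘ fun x => x - μ := rfl
  have hdet : L⁻¹.det = L.det⁻¹ := by rw [Matrix.det_nonsing_inv, Ring.inverse_eq_inv']
  have hne : L⁻¹.det ≠ 0 := by rw [hdet]; exact inv_ne_zero hL.ne_zero
  rw [h, ← Measure.map_map (toLin' L⁻¹).continuous_of_finiteDimensional.measurable
    (measurable_sub_const μ), (measurePreserving_sub_right volume μ).map_eq,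
    Real.map_matrix_volume_pi_eq_smul_volume_pi hne, hdet, inv_inv]

lemma integrable_comp_whiten {g : (Fin N → ℝ) → ℝ} (hg : Integrable g) :
    Integrable fun x => g (whiten μ L x) := by
  refine Integrable.comp_measurable ?_ (contDiff_whiten (n := 0) μ).continuous.measurable
  rw [map_whiten_volume μ hL]
  exact hg.smul_measure ENNReal.ofReal_ne_top

lemma integral_comp_whiten {g : (Fin N → ℝ) → ℝ} (hg : Continuous g) :
    ∫ x, g (whiten μ L x) = |L.det| * ∫ z, g z := by
  rw [← integral_map (contDiff_whiten (n := 0) μ).continuous.aemeasurable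
    hg.aestronglyMeasurable, map_whiten_volume μ hL, integral_smul_measure,
    ENNReal.toReal_ofReal (abs_nonneg _), smul_eq_mul]

omit hL in
lemma exp_mul_dotProduct_self (s : ℝ) (z : Fin N → ℝ) :
    Real.exp (s * (z ⬝ᵥ z)) = ∏ i, Real.exp (s * z i ^ 2) := by
  rw [← Real.exp_sum, dotProduct, Finset.mul_sum]
  simp only [sq]

omit hL in
lemma integrable_exp_neg_mul_dotProduct {s : ℝ} (hs : 0 < s) :
    Integrable fun z : Fin N → ℝ => Real.exp (-s * (z ⬝ᵥ z)) := by
  simp_rw [exp_mul_dotProduct_self]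
  exact Integrable.fintype_prod fun _ => integrable_exp_neg_mul_sq hs

omit hL in
lemma integral_exp_neg_half_dotProduct :
    ∫ z : Fin N → ℝ, Real.exp (-(1 / 2) * (z ⬝ᵥ z)) = Real.sqrt ((2 * π) ^ N) := by
  simp_rw [exp_mul_dotProduct_self]
  rw [integral_fintype_prod_volume_eq_pow (fun t : ℝ => Real.exp (-(1 / 2) * t ^ 2)),
    integral_gaussian, Fintype.card_fin, div_div_eq_mul_div, div_one, mul_comm π,
    Real.sqrt_eq_rpow, Real.sqrt_eq_rpow, ← Real.rpow_natCast, ← Real.rpow_natCast,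
    ← Real.rpow_mul (by positivity), ← Real.rpow_mul (by positivity), mul_comm (1 / 2 : ℝ)]

omit hL in
lemma integrable_exp_mul_apply_mul_apply (a b : Fin N) :
    Integrable fun z : Fin N → ℝ => Real.exp (-(1 / 2) * (z ⬝ᵥ z)) * (z a * z b) := by
  refine ((integrable_exp_neg_mul_dotProduct (N := N) (s := 1 / 4) (by norm_num)).const_mul
    4).mono' (Continuous.aestronglyMeasurable ?_) (.of_forall fun z => ?_)
  · simp only [dotProduct]
    fun_prop
  · have hsq : ∀ i, z i ^ 2 ≤ z ⬝ᵥ z := fun i => by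
      simp only [dotProduct, ← sq]
      exact Finset.single_le_sum (f := fun i => z i ^ 2) (fun i _ => sq_nonneg _)
        (Finset.mem_univ i)
    have hab : |z a * z b| ≤ z ⬝ᵥ z := by
      have ha := hsq a
      have hb := hsq b
      rw [abs_le]
      constructor <;> nlinarith [sq_nonneg (z a + z b), sq_nonneg (z a - z b)]
    have he : z ⬝ᵥ z ≤ 4 * Real.exp (1 / 4 * (z ⬝ᵥ z)) := by
      linarith [Real.add_one_le_exp (1 / 4 * (z ⬝ᵥ z))]
    rw [norm_mul, Real.norm_eq_abs, Real.abs_exp, Real.norm_eq_abs]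
    calc Real.exp (-(1 / 2) * (z ⬝ᵥ z)) * |z a * z b|
        ≤ Real.exp (-(1 / 2) * (z ⬝ᵥ z)) * (4 * Real.exp (1 / 4 * (z ⬝ᵥ z))) :=
          mul_le_mul_of_nonneg_left (hab.trans he) (Real.exp_pos _).le
      _ = 4 * Real.exp (-(1 / 4) * (z ⬝ᵥ z)) := by
          rw [mul_left_comm, ← Real.exp_add]
          ring_nf

omit hL in
lemma gaussPi_eq_withDensity_whiten : gaussPi N μ (L * Lᵀ) =
    volume.withDensity fun x => ENNReal.ofReal ((Real.sqrt ((2 * π) ^ N * (L * Lᵀ).det))⁻¹ *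
      Real.exp (-(1 / 2) * (whiten μ L x ⬝ᵥ whiten μ L x))) := by
  have h : ∀ x, (x - μ) ⬝ᵥ (L * Lᵀ)⁻¹ *ᵥ (x - μ) = whiten μ L x ⬝ᵥ whiten μ L x := fun x => by
    rw [Matrix.mul_inv_rev, ← Matrix.mulVec_mulVec, Matrix.dotProduct_mulVec,
      ← Matrix.transpose_nonsing_inv, Matrix.vecMul_transpose, whiten]
  simp only [gaussPi, h]

lemma gaussPi_normalization_pos : 0 < (Real.sqrt ((2 * π) ^ N * (L * Lᵀ).det))⁻¹ := by
  have : 0 < L.det * L.det := mul_self_pos.2 hL.ne_zero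
  rw [Matrix.det_mul, Matrix.det_transpose]
  positivity

omit hL in
lemma measurable_gaussPi_density (C : ℝ) : Measurable fun x => ENNReal.ofReal
    (C * Real.exp (-(1 / 2) * (whiten μ L x ⬝ᵥ whiten μ L x))) :=
  (((contDiff_whiten_dot (n := 0) μ).continuous.measurable.const_mul _).exp.const_mul
    C).ennreal_ofReal

lemma integrable_gaussPi_iff {f : (Fin N → ℝ) → ℝ} : Integrable f (gaussPi N μ (L * Lᵀ)) ↔
    Integrable fun x => Real.exp (-(1 / 2) * (whiten μ L x ⬝ᵥ whiten μ L x)) * f x := by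
  have hC := gaussPi_normalization_pos hL
  rw [gaussPi_eq_withDensity_whiten, integrable_withDensity_iff_integrable_smul'
    (measurable_gaussPi_density μ _) (.of_forall fun x => ENNReal.ofReal_lt_top)]
  simp_rw [ENNReal.toReal_ofReal (mul_pos hC (Real.exp_pos _)).le, smul_eq_mul, mul_assoc]
  exact integrable_const_mul_iff hC.ne'.isUnit _

lemma integral_gaussPi (f : (Fin N → ℝ) → ℝ) : ∫ x, f x ∂(gaussPi N μ (L * Lᵀ)) =
    (Real.sqrt ((2 * π) ^ N * (L * Lᵀ).det))⁻¹ *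
      ∫ x, Real.exp (-(1 / 2) * (whiten μ L x ⬝ᵥ whiten μ L x)) * f x := by
  have hC := gaussPi_normalization_pos hL
  rw [gaussPi_eq_withDensity_whiten, integral_withDensity_eq_integral_toReal_smul
    (measurable_gaussPi_density μ _) (.of_forall fun x => ENNReal.ofReal_lt_top)]
  simp_rw [ENNReal.toReal_ofReal (mul_pos hC (Real.exp_pos _)).le, smul_eq_mul, mul_assoc]
  exact integral_const_mul _ _

lemma integrable_one_gaussPi : Integrable (fun _ => (1 : ℝ)) (gaussPi N μ (L * Lᵀ)) := by
  rw [integrable_gaussPi_iff μ hL]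
  simpa using integrable_comp_whiten μ hL
    (integrable_exp_neg_mul_dotProduct (N := N) (s := 1 / 2) (by norm_num))

lemma integral_one_gaussPi : ∫ _, (1 : ℝ) ∂(gaussPi N μ (L * Lᵀ)) = 1 := by
  have hC := gaussPi_normalization_pos hL
  have h := integral_comp_whiten μ hL (g := fun z => Real.exp (-(1 / 2) * (z ⬝ᵥ z)))
    (by simp only [dotProduct]; fun_prop)
  rw [integral_gaussPi μ hL]
  simp only [mul_one]
  rw [h, integral_exp_neg_half_dotProduct, inv_mul_eq_one₀ (inv_pos.1 hC).ne',
    Matrix.det_mul, Matrix.det_transpose, Real.sqrt_mul (by positivity), Real.sqrt_mul_self_eq_abs,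
    mul_comm]

lemma isProbabilityMeasure_gaussPi : IsProbabilityMeasure (gaussPi N μ (L * Lᵀ)) := by
  have : IsFiniteMeasure (gaussPi N μ (L * Lᵀ)) :=
    (integrable_const_iff_isFiniteMeasure one_ne_zero).1 (integrable_one_gaussPi μ hL)
  have h := integral_one_gaussPi μ hL
  rw [integral_const, smul_eq_mul, mul_one] at h
  exact ⟨by rwa [measureReal_def, ENNReal.toReal_eq_one_iff] at h⟩

lemma integrable_whiten_mul_whiten_gaussPi (a b : Fin N) :
    Integrable (fun x => whiten μ L x a * whiten μ L x b) (gaussPi N μ (L * Lᵀ)) := by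
  rw [integrable_gaussPi_iff μ hL]
  exact integrable_comp_whiten μ hL (integrable_exp_mul_apply_mul_apply a b)

/-- Stein's identity of second order for `N(μ, LLᵀ)`, in the directions of the columns of `L`. -/
lemma integral_stein_gaussPi {f : (Fin N → ℝ) → ℝ} (hf : ContDiff ℝ 2 f) (a b : Fin N)
    (h0 : Integrable f (gaussPi N μ (L * Lᵀ)))
    (h1 : Integrable (fun x => whiten μ L x a * whiten μ L x b * f x) (gaussPi N μ (L * Lᵀ)))
    (h2 : Integrable (fun x => fderiv ℝ (fun y => fderiv ℝ f y (L *ᵥ Pi.single b 1)) x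
      (L *ᵥ Pi.single a 1)) (gaussPi N μ (L * Lᵀ))) :
    ∫ x, fderiv ℝ (fun y => fderiv ℝ f y (L *ᵥ Pi.single b 1)) x (L *ᵥ Pi.single a 1)
        ∂(gaussPi N μ (L * Lᵀ)) =
      (∫ x, whiten μ L x a * whiten μ L x b * f x ∂(gaussPi N μ (L * Lᵀ))) -
      (if a = b then 1 else 0) * ∫ x, f x ∂(gaussPi N μ (L * Lᵀ)) := by
  rw [integrable_gaussPi_iff μ hL] at h0 h1 h2
  simp only [integral_gaussPi μ hL]
  rw [integral_stein_weight μ hL hf a b h0 h1 h2]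
  ring

lemma integral_whiten_mul_whiten_gaussPi (a b : Fin N) :
    ∫ x, whiten μ L x a * whiten μ L x b ∂(gaussPi N μ (L * Lᵀ)) = if a = b then 1 else 0 := by
  have h := integral_stein_gaussPi μ hL (f := fun _ => 1) contDiff_const a b
    (integrable_one_gaussPi μ hL)
    (by simpa using integrable_whiten_mul_whiten_gaussPi μ hL a b) (by simp)
  rw [integral_one_gaussPi μ hL] at h
  simp only [mul_one, fderiv_fun_const, Pi.zero_apply, _root_.zero_apply,
    integral_zero] at h
  linarith

end Whitening

lemma fderiv_fderiv_apply_eq {E : Type*} [NormedAddCommGroup E] [NormedSpace ℝ E] {f : E → ℝ}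
    (hf : ContDiff ℝ 2 f) (x u v : E) :
    fderiv ℝ (fun y => fderiv ℝ f y v) x u = fderiv ℝ (fderiv ℝ f) x u v := by
  have h : DifferentiableAt ℝ (fderiv ℝ f) x :=
    (hf.fderiv_right (m := 1) (by norm_num)).differentiable one_ne_zero x
  rw [fderiv_clm_apply h (differentiableAt_const v)]
  simp

/-- The second derivative along columns of `L` in terms of second partial derivatives. -/
lemma fderiv_fderiv_mulVec_single {N : ℕ} (L : Matrix (Fin N) (Fin N) ℝ) {f : (Fin N → ℝ) → ℝ}
    (hf : ContDiff ℝ 2 f) (a b : Fin N) (x : Fin N → ℝ) :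
    fderiv ℝ (fun y => fderiv ℝ f y (L *ᵥ Pi.single b 1)) x (L *ᵥ Pi.single a 1) =
      ∑ j, ∑ i, L i a *
        fderiv ℝ (fun y => fderiv ℝ f y (Pi.single j 1)) x (Pi.single i 1) * L j b := by
  have hcol : ∀ c, L *ᵥ Pi.single c 1 = ∑ i, L i c • (Pi.single i 1 : Fin N → ℝ) := fun c => by
    rw [Matrix.mulVec_single_one]
    exact pi_eq_sum_univ' _
  simp only [fderiv_fderiv_apply_eq hf]
  rw [hcol a, hcol b]
  simp only [map_sum, map_smul, _root_.sum_apply, _root_.smul_apply, smul_eq_mul, Finset.mul_sum]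
  exact Finset.sum_congr rfl fun j _ => Finset.sum_congr rfl fun i _ => by ring

/-- **Quadratic-block projection coordinates onto the indefinite-Gaussian subspace.**
For `p = c·exp (-φ)` in Bayes space with Gaussian measure `ν = N(μ, Σ)`, `Σ = LLᵀ`, the
quadratic-block projection coefficients satisfy
`α₂ = ⟨g₂, p⟩ = √((1/2)DᵀD)·vech (Lᵀ·E_ν[∂²φ/∂xᵀ∂x]·L)`, and consequently
`α₂ᵀγ₂(x) = (1/2)(x−μ)ᵀ E_ν[∂²φ/∂xᵀ∂x] (x−μ)`. -/
theorem indefGaussian_second_coordinates (N M : ℕ) (hM : M = N * (N + 1) / 2)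
    (μ : Fin N → ℝ) (L : Matrix (Fin N) (Fin N) ℝ) (hL : IsUnit L.det)
    (vech : Matrix (Fin N) (Fin N) ℝ → Fin M → ℝ)
    (D : Matrix (Fin N × Fin N) (Fin M) ℝ)
    (hD : ∀ A : Matrix (Fin N) (Fin N) ℝ, A.IsSymm →
      ∀ ij : Fin N × Fin N, (D.mulVec (vech A)) ij = A ij.1 ij.2)
    (R : Matrix (Fin M) (Fin M) ℝ) (hR : R * R = (2⁻¹ : ℝ) • (Dᵀ * D)) (hRs : R.IsSymm)
    (c : ℝ) (hc : 0 < c) (φ : (Fin N → ℝ) → ℝ) (hφ : ContDiff ℝ 2 φ)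
    (hint₁ : Integrable φ (gaussPi N μ (L * Lᵀ)))
    (hint₂ : ∀ k, Integrable
      (fun x => (R.mulVec (vech (L⁻¹ * vecMulVec (x - μ) (x - μ) * (L⁻¹)ᵀ))) k * φ x)
      (gaussPi N μ (L * Lᵀ)))
    (hint₃ : ∀ i j, Integrable
      (fun x => fderiv ℝ (fun y => fderiv ℝ φ y (Pi.single j 1)) x (Pi.single i 1))
      (gaussPi N μ (L * Lᵀ))) :
    (∀ k, bip (gaussPi N μ (L * Lᵀ)) (gTwo N M μ L vech R k) (fun x => c * Real.exp (-(φ x))) =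
      (R.mulVec (vech (Lᵀ *
        (Matrix.of fun i j => ∫ x,
          fderiv ℝ (fun y => fderiv ℝ φ y (Pi.single j 1)) x (Pi.single i 1)
            ∂(gaussPi N μ (L * Lᵀ))) * L))) k) ∧
    (∀ x, (R.mulVec (vech (Lᵀ *
        (Matrix.of fun i j => ∫ y,
          fderiv ℝ (fun z => fderiv ℝ φ z (Pi.single j 1)) y (Pi.single i 1)
            ∂(gaussPi N μ (L * Lᵀ))) * L))) ⬝ᵥ
          (R.mulVec (vech (L⁻¹ * vecMulVec (x - μ) (x - μ) * (L⁻¹)ᵀ))) =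
      (1 / 2) * ((x - μ) ⬝ᵥ
        (Matrix.of fun i j => ∫ y,
          fderiv ℝ (fun z => fderiv ℝ φ z (Pi.single j 1)) y (Pi.single i 1)
            ∂(gaussPi N μ (L * Lᵀ))).mulVec (x - μ))) := by
  have hprob := isProbabilityMeasure_gaussPi μ hL
  set ν := gaussPi N μ (L * Lᵀ) with hν
  set H : Matrix (Fin N) (Fin N) ℝ := Matrix.of fun i j => ∫ x,
    fderiv ℝ (fun y => fderiv ℝ φ y (Pi.single j 1)) x (Pi.single i 1) ∂ν with hH
  have hHs : H.IsSymm := by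
    ext i j
    simp only [hH, Matrix.transpose_apply, Matrix.of_apply]
    refine integral_congr_ae (.of_forall fun x => ?_)
    simp only [fderiv_fderiv_apply_eq hφ]
    exact (hφ.contDiffAt.isSymmSndFDerivAt (by simp)).eq _ _
  have hAs : (Lᵀ * H * L).IsSymm := by
    rw [Matrix.IsSymm, Matrix.transpose_mul, Matrix.transpose_mul, hHs.eq,
      Matrix.transpose_transpose, Matrix.mul_assoc]
  have hz : ∀ x, L⁻¹ * vecMulVec (x - μ) (x - μ) * (L⁻¹)ᵀ =
      vecMulVec (whiten μ L x) (whiten μ L x) := fun x => mul_vecMulVec_mul_transpose _ _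
  simp only [hz] at hint₂ ⊢
  refine ⟨fun k => ?_, fun x => ?_⟩
  · obtain ⟨Q, T, hQT⟩ := weighted_vech_linear hM hD hR
    have hγ : ∀ x k, R.mulVec (vech (vecMulVec (whiten μ L x) (whiten μ L x))) k =
        ∑ ab : Fin N × Fin N, Q k ab * (whiten μ L x ab.1 * whiten μ L x ab.2) :=
      fun x => (hQT _ (isSymm_vecMulVec_self _)).1
    have hzφ : ∀ a b, Integrable (fun x => whiten μ L x a * whiten μ L x b * φ x) ν := by
      intro a b
      have h := integrable_finsetSum Finset.univ fun k _ => (hint₂ k).const_mul (T (a, b) k)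
      refine h.congr (.of_forall fun x => ?_)
      have := (hQT _ (isSymm_vecMulVec_self (whiten μ L x))).2 (a, b)
      rw [vecMulVec_apply] at this
      simp only [this, Finset.sum_mul, mul_assoc]
    have hA : ∀ a b, (Lᵀ * H * L) a b =
        (∫ x, whiten μ L x a * whiten μ L x b * φ x ∂ν) -
          (if a = b then 1 else 0) * ∫ x, φ x ∂ν := by
      intro a b
      have hi : ∀ i j, Integrable (fun x => L i a *
          fderiv ℝ (fun y => fderiv ℝ φ y (Pi.single j 1)) x (Pi.single i 1) * L j b) ν :=
        fun i j => ((hint₃ i j).const_mul _).mul_const _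
      rw [← integral_stein_gaussPi μ hL hφ a b hint₁ (hzφ a b)]
      · simp only [fderiv_fderiv_mulVec_single L hφ]
        rw [integral_finsetSum _ fun j _ => integrable_finsetSum _ fun i _ => hi i j]
        simp only [Matrix.mul_apply, Matrix.transpose_apply, Finset.sum_mul]
        refine Finset.sum_congr rfl fun j _ => ?_
        rw [integral_finsetSum _ fun i _ => hi i j]
        refine Finset.sum_congr rfl fun i _ => ?_
        rw [integral_mul_const, integral_const_mul]
        rfl
      · simp only [fderiv_fderiv_mulVec_single L hφ]
        exact integrable_finsetSum _ fun j _ => integrable_finsetSum _ fun i _ => hi i j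
    have hγi : Integrable
        (fun x => R.mulVec (vech (vecMulVec (whiten μ L x) (whiten μ L x))) k) ν := by
      simp only [hγ]
      exact integrable_finsetSum _ fun ab _ =>
        (integrable_whiten_mul_whiten_gaussPi μ hL ab.1 ab.2).const_mul _
    have hγ1 : ∫ x, R.mulVec (vech (vecMulVec (whiten μ L x) (whiten μ L x))) k ∂ν =
        ∑ ab : Fin N × Fin N, Q k ab * (if ab.1 = ab.2 then 1 else 0) := by
      simp only [hγ]
      rw [integral_finsetSum _ fun ab _ =>
        (integrable_whiten_mul_whiten_gaussPi μ hL ab.1 ab.2).const_mul _]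
      simp only [integral_const_mul, hν, integral_whiten_mul_whiten_gaussPi μ hL]
    have hγφ : ∫ x, R.mulVec (vech (vecMulVec (whiten μ L x) (whiten μ L x))) k * φ x ∂ν =
        ∑ ab : Fin N × Fin N, Q k ab * ∫ x, whiten μ L x ab.1 * whiten μ L x ab.2 * φ x ∂ν := by
      simp only [hγ, Finset.sum_mul, mul_assoc (Q k _)]
      rw [integral_finsetSum _ fun ab _ => (hzφ ab.1 ab.2).const_mul _]
      simp only [integral_const_mul]
    have hlog : ∀ x, Real.log (c * Real.exp (-(φ x))) = Real.log c - φ x := fun x => by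
      rw [Real.log_mul hc.ne' (Real.exp_pos _).ne', Real.log_exp, sub_eq_add_neg]
    have hbip : bip ν (gTwo N M μ L vech R k) (fun x => c * Real.exp (-(φ x))) =
        (∫ x, R.mulVec (vech (vecMulVec (whiten μ L x) (whiten μ L x))) k * φ x ∂ν) -
          (∫ x, R.mulVec (vech (vecMulVec (whiten μ L x) (whiten μ L x))) k ∂ν) *
            ∫ x, φ x ∂ν := by
      simp only [bip, gTwo, Real.log_exp, hlog, hz]
      have h1 : ∀ x, -R.mulVec (vech (vecMulVec (whiten μ L x) (whiten μ L x))) k *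
          (Real.log c - φ x) =
          R.mulVec (vech (vecMulVec (whiten μ L x) (whiten μ L x))) k * φ x -
            R.mulVec (vech (vecMulVec (whiten μ L x) (whiten μ L x))) k * Real.log c :=
        fun x => by ring
      simp only [h1]
      rw [integral_sub (hint₂ k) (hγi.mul_const _), integral_mul_const, integral_neg,
        integral_sub (integrable_const _) hint₁, integral_const, probReal_univ, one_smul]
      ring
    rw [hbip, hγ1, hγφ, (hQT _ hAs).1, Finset.sum_mul, ← Finset.sum_sub_distrib]
    refine Finset.sum_congr rfl fun ab _ => ?_
    rw [hA]
    ring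
  · rw [weighted_vech_dotProduct hD hR hRs hAs (isSymm_vecMulVec_self _), sum_mul_vecMulVec,
      one_div]
    congr 1
    have hLz : L *ᵥ whiten μ L x = x - μ := by
      rw [whiten, Matrix.mulVec_mulVec, Matrix.mul_nonsing_inv L hL, Matrix.one_mulVec]
    rw [← Matrix.mulVec_mulVec, ← Matrix.mulVec_mulVec, Matrix.dotProduct_mulVec,
      Matrix.vecMul_transpose, hLz]
end
end

section
/- With Gaussian measure ν = N(μ, Σ), the Bayes-space projection of the indefinite Gaussian g = exp(-(1/2)(x−μ′)ᵀΣ′⁻¹(x−μ′)) has coordinates α₁ = LᵀΣ′⁻¹(μ−μ′) and α₂ = √((1/2)DᵀD)·D†·vec(LᵀΣ′⁻¹L), and its information is I(g) = (1/2)[(μ−μ′)ᵀΣ′⁻¹ΣΣ′⁻¹(μ−μ′) + (1/2)tr(Σ′⁻¹ΣΣ′⁻¹Σ)]. -/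
open MeasureTheory Real Matrix

noncomputable section

open ProbabilityTheory

/-- The law of a vector of `N` independent standard Gaussians. -/
def stdGaussPi (N : ℕ) : Measure (Fin N → ℝ) := Measure.pi fun _ => gaussianReal 0 1

lemma stdGaussPi_eq_withDensity (N : ℕ) :
    stdGaussPi N = volume.withDensity
      fun z => ENNReal.ofReal (∏ i, gaussianPDFReal 0 1 (z i)) := by
  refine Measure.pi_eq fun s hs => ?_
  have hint : Integrable (fun z : Fin N → ℝ => ∏ i, gaussianPDFReal 0 1 (z i))
      (volume.restrict (Set.univ.pi s)) :=
    (Integrable.fintype_prod (fun _ => integrable_gaussianPDFReal 0 1)).restrict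
  rw [withDensity_apply _ (MeasurableSet.univ_pi hs),
    ← ofReal_integral_eq_lintegral_ofReal hint (ae_of_all _ fun z =>
      Finset.prod_nonneg fun i _ => gaussianPDFReal_nonneg 0 1 (z i)),
    volume_pi, Measure.restrict_pi_pi,
    integral_fintype_prod_eq_prod (fun _ => gaussianPDFReal 0 1),
    ENNReal.ofReal_prod_of_nonneg fun i _ =>
      integral_nonneg fun x => gaussianPDFReal_nonneg 0 1 x]
  exact Finset.prod_congr rfl fun i _ =>
    (gaussianReal_apply_eq_integral 0 one_ne_zero (s i)).symm

lemma prod_gaussianPDFReal {N : ℕ} (z : Fin N → ℝ) :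
    ∏ i, gaussianPDFReal 0 1 (z i) =
      (Real.sqrt ((2 * π) ^ N))⁻¹ * Real.exp (-(1 / 2) * (z ⬝ᵥ z)) := by
  simp only [gaussianPDFReal, Finset.prod_mul_distrib, ← Real.exp_sum, dotProduct,
    Finset.mul_sum, Finset.prod_const, Finset.card_univ, Fintype.card_fin, inv_pow]
  congr 2
  · rw [Real.sqrt_eq_rpow, Real.sqrt_eq_rpow, ← Real.rpow_natCast, ← Real.rpow_mul (by positivity),
      mul_comm (1 / 2 : ℝ), Real.rpow_mul (by positivity), Real.rpow_natCast]
    simp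
  · refine Finset.sum_congr rfl fun i _ => ?_
    simp only [NNReal.coe_one]
    ring

lemma integral_gaussPi_s19 {N : ℕ} (μ : Fin N → ℝ) (L : Matrix (Fin N) (Fin N) ℝ)
    (hL : IsUnit L.det) (f : (Fin N → ℝ) → ℝ) :
    ∫ x, f x ∂(gaussPi N μ (L * Lᵀ)) = ∫ z, f (μ + L.mulVec z) ∂(stdGaussPi N) := by
  have hdet : L.det ≠ 0 := hL.ne_zero
  have hinv : ∀ z, L⁻¹.mulVec (L.mulVec z) = z := fun z => by
    rw [mulVec_mulVec, nonsing_inv_mul _ hL, one_mulVec]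
  have hquad : ∀ z, (L.mulVec z) ⬝ᵥ ((L * Lᵀ)⁻¹.mulVec (L.mulVec z)) = z ⬝ᵥ z := fun z => by
    rw [Matrix.mul_inv_rev, ← mulVec_mulVec, hinv, ← transpose_nonsing_inv, dotProduct_mulVec,
      vecMul_transpose, hinv]
  have hρ : Measurable fun x : Fin N → ℝ => ENNReal.ofReal
      ((Real.sqrt ((2 * π) ^ N * (L * Lᵀ).det))⁻¹ *
        Real.exp (-(1 / 2) * ((x - μ) ⬝ᵥ (L * Lᵀ)⁻¹.mulVec (x - μ)))) := by
    refine Measurable.ennreal_ofReal (Continuous.measurable ?_)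
    fun_prop
  have hw : Measurable fun z : Fin N → ℝ =>
      ENNReal.ofReal (∏ i, gaussianPDFReal 0 1 (z i)) := by
    refine Measurable.ennreal_ofReal (Finset.measurable_fun_prod _ fun i _ => ?_)
    exact (measurable_gaussianPDFReal 0 1).comp (measurable_pi_apply i)
  rw [gaussPi, stdGaussPi_eq_withDensity,
    integral_withDensity_eq_integral_toReal_smul hρ (ae_of_all _ fun _ => ENNReal.ofReal_lt_top),
    integral_withDensity_eq_integral_toReal_smul hw (ae_of_all _ fun _ => ENNReal.ofReal_lt_top)]
  set A : (Fin N → ℝ) →L[ℝ] (Fin N → ℝ) := LinearMap.toContinuousLinearMap (toLin' L) with hA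
  have hAz : ∀ z, A z = L.mulVec z := fun z => by simp [hA]
  have hder : ∀ z ∈ Set.univ, HasFDerivWithinAt (fun z => μ + L.mulVec z) A Set.univ z := by
    intro z _
    simpa [hAz] using (A.hasFDerivWithinAt (s := Set.univ) (x := z)).const_add μ
  have hinj : Set.InjOn (fun z => μ + L.mulVec z) Set.univ := by
    intro x _ y _ hxy
    rw [← hinv x, ← hinv y, add_left_cancel hxy]
  have himage : (fun z => μ + L.mulVec z) '' Set.univ = Set.univ := by
    refine Set.eq_univ_of_forall fun x => ⟨L⁻¹.mulVec (x - μ), trivial, ?_⟩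
    simp [mulVec_mulVec, mul_nonsing_inv _ hL]
  have hdetA : A.det = L.det := by
    simp [hA, ContinuousLinearMap.det]
  have hcv := integral_image_eq_integral_abs_det_fderiv_smul volume MeasurableSet.univ hder hinj
    (fun x => (ENNReal.ofReal ((Real.sqrt ((2 * π) ^ N * (L * Lᵀ).det))⁻¹ *
        Real.exp (-(1 / 2) * ((x - μ) ⬝ᵥ (L * Lᵀ)⁻¹.mulVec (x - μ))))).toReal • f x)
  rw [himage, Measure.restrict_univ] at hcv
  rw [hcv]
  refine integral_congr_ae (ae_of_all _ fun z => ?_)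
  simp only [hdetA, add_sub_cancel_left, hquad, smul_eq_mul]
  rw [ENNReal.toReal_ofReal (by positivity), ENNReal.toReal_ofReal
    (Finset.prod_nonneg fun i _ => gaussianPDFReal_nonneg 0 1 (z i)), prod_gaussianPDFReal,
    det_mul, det_transpose, Real.sqrt_mul (by positivity), Real.sqrt_mul_self_eq_abs]
  have : |L.det| ≠ 0 := abs_ne_zero.2 hdet
  field_simp

lemma integrable_pow_gaussianReal (n : ℕ) : Integrable (fun x => x ^ n) (gaussianReal 0 1) :=
  integrable_pow_of_mem_interior_integrableExpSet (X := fun x : ℝ => x)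
    (by simp [integrableExpSet_fun_id_gaussianReal]) n

lemma integral_pow_gaussianReal_eq (n : ℕ) :
    ∫ x, x ^ n ∂(gaussianReal 0 1) = iteratedDeriv n (fun t : ℝ => Real.exp (t ^ 2 / 2)) 0 := by
  have h := iteratedDeriv_mgf_zero (X := id) (μ := gaussianReal 0 1) (by simp) n
  rw [mgf_id_gaussianReal] at h
  simpa using h.symm

lemma deriv_mul_exp_sq_half {p : ℝ → ℝ} {p' : ℝ → ℝ} (hp : ∀ t, HasDerivAt p (p' t) t) :
    deriv (fun t => p t * Real.exp (t ^ 2 / 2)) =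
      fun t => (p' t + t * p t) * Real.exp (t ^ 2 / 2) := by
  ext t
  have h : HasDerivAt (fun t : ℝ => t ^ 2 / 2) t t := by
    simpa using (hasDerivAt_pow 2 t).div_const 2
  refine (((hp t).mul h.exp).deriv).trans ?_
  ring

lemma moments_gaussianReal :
    ∫ x, x ^ 1 ∂(gaussianReal 0 1) = 0 ∧ ∫ x, x ^ 2 ∂(gaussianReal 0 1) = 1 ∧
      ∫ x, x ^ 3 ∂(gaussianReal 0 1) = 0 ∧ ∫ x, x ^ 4 ∂(gaussianReal 0 1) = 3 := by
  have h1 : iteratedDeriv 1 (fun t : ℝ => Real.exp (t ^ 2 / 2)) =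
      fun t => t * Real.exp (t ^ 2 / 2) := by
    have := deriv_mul_exp_sq_half (fun t => hasDerivAt_const t (1 : ℝ))
    simpa [iteratedDeriv_one] using this
  have h2 : iteratedDeriv 2 (fun t : ℝ => Real.exp (t ^ 2 / 2)) =
      fun t => (1 + t * t) * Real.exp (t ^ 2 / 2) := by
    rw [iteratedDeriv_succ, h1, deriv_mul_exp_sq_half hasDerivAt_id']
  have h3 : iteratedDeriv 3 (fun t : ℝ => Real.exp (t ^ 2 / 2)) =
      fun t => ((1 * t + t * 1) + t * (1 + t * t)) * Real.exp (t ^ 2 / 2) := by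
    rw [iteratedDeriv_succ, h2]
    exact deriv_mul_exp_sq_half fun t =>
      ((hasDerivAt_id' t).mul (hasDerivAt_id' t)).const_add 1
  have h4 : iteratedDeriv 4 (fun t : ℝ => Real.exp (t ^ 2 / 2)) 0 = 3 := by
    have hd : ∀ t : ℝ, HasDerivAt (fun t : ℝ => (1 * t + t * 1) + t * (1 + t * t))
        (3 + 3 * t ^ 2) t := fun t => by
      have h := ((hasDerivAt_id' t).const_mul 3).add (hasDerivAt_pow 3 t)
      convert! h using 1
      · ext t
        simp only [Pi.add_apply]
        ring
      · simp
    rw [iteratedDeriv_succ, h3, deriv_mul_exp_sq_half hd]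
    simp
  simp [integral_pow_gaussianReal_eq, h2, h3, h4]

lemma integrable_monomial {N : ℕ} (c : Fin N → ℕ) :
    Integrable (fun z => ∏ n, z n ^ c n) (stdGaussPi N) :=
  Integrable.fintype_prod (fun n => integrable_pow_gaussianReal (c n))

lemma integral_monomial {N : ℕ} (c : Fin N → ℕ) :
    ∫ z, ∏ n, z n ^ c n ∂(stdGaussPi N) = ∏ n, ∫ x, x ^ c n ∂(gaussianReal 0 1) :=
  integral_fintype_prod_eq_prod (fun n (x : ℝ) => x ^ c n)

lemma prod_map_eq_monomial {N : ℕ} (l : List (Fin N)) (z : Fin N → ℝ) :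
    (l.map z).prod = ∏ n, z n ^ l.count n := by
  rw [Finset.prod_list_map_count]
  refine Finset.prod_subset (Finset.subset_univ _) fun n _ hn => ?_
  rw [List.count_eq_zero_of_not_mem (by simpa using hn), pow_zero]

lemma integrable_prod_map {N : ℕ} (l : List (Fin N)) :
    Integrable (fun z => (l.map z).prod) (stdGaussPi N) := by
  simpa only [prod_map_eq_monomial] using integrable_monomial fun n => l.count n

lemma integral_prod_map {N : ℕ} (l : List (Fin N)) :
    ∫ z, (l.map z).prod ∂(stdGaussPi N) = ∏ n, ∫ x, x ^ l.count n ∂(gaussianReal 0 1) := by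
  simpa only [prod_map_eq_monomial] using integral_monomial fun n => l.count n

lemma integral_one_stdGaussPi (N : ℕ) : ∫ _, (1 : ℝ) ∂(stdGaussPi N) = 1 := by
  simpa using integral_prod_map ([] : List (Fin N))

lemma integral_coord {N : ℕ} (i : Fin N) : ∫ z, z i ∂(stdGaussPi N) = 0 := by
  have h := integral_prod_map [i]
  simp only [List.map_cons, List.map_nil, List.prod_cons, List.prod_nil, mul_one] at h
  rw [h]
  obtain ⟨m1, m2, m3, m4⟩ := moments_gaussianReal
  refine Finset.prod_eq_zero (Finset.mem_univ i) ?_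
  simp

lemma integral_coord_mul₂ {N : ℕ} (i j : Fin N) :
    ∫ z, z i * z j ∂(stdGaussPi N) = if i = j then 1 else 0 := by
  have h := integral_prod_map [i, j]
  simp only [List.map_cons, List.map_nil, List.prod_cons, List.prod_nil, mul_one] at h
  rw [h]
  obtain ⟨m1, m2, m3, m4⟩ := moments_gaussianReal
  split_ifs with hij
  · subst hij
    refine Finset.prod_eq_one fun n _ => ?_
    by_cases hn : i = n <;> simp [hn, m2]
  · refine Finset.prod_eq_zero (Finset.mem_univ i) ?_
    simp [Ne.symm hij]

lemma integral_coord_mul₃ {N : ℕ} (i j k : Fin N) :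
    ∫ z, z i * (z j * z k) ∂(stdGaussPi N) = 0 := by
  have h := integral_prod_map [i, j, k]
  simp only [List.map_cons, List.map_nil, List.prod_cons, List.prod_nil, mul_one] at h
  rw [h]
  obtain ⟨m1, m2, m3, m4⟩ := moments_gaussianReal
  by_cases hij : i = j
  · subst hij
    refine Finset.prod_eq_zero (Finset.mem_univ k) ?_
    by_cases hik : i = k
    · simpa [List.count_cons, hik] using m3
    · simp [hik]
  · by_cases hik : i = k
    · refine Finset.prod_eq_zero (Finset.mem_univ j) ?_
      simp [hij, ← hik]
    · refine Finset.prod_eq_zero (Finset.mem_univ i) ?_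
      simp [Ne.symm hij, Ne.symm hik]

lemma integral_coord_mul₄ {N : ℕ} (i j k l : Fin N) :
    ∫ z, z i * z j * (z k * z l) ∂(stdGaussPi N) =
      (if i = j then 1 else 0) * (if k = l then 1 else 0) +
      (if i = k then 1 else 0) * (if j = l then 1 else 0) +
      (if i = l then 1 else 0) * (if j = k then 1 else 0) := by
  have h := integral_prod_map [i, j, k, l]
  simp only [List.map_cons, List.map_nil, List.prod_cons, List.prod_nil, mul_one,
    ← mul_assoc] at h
  simp only [← mul_assoc]
  rw [h]
  obtain ⟨m1, m2, m3, m4⟩ := moments_gaussianReal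
  have hpair : ∀ a b : Fin N, a ≠ b → ∀ s : List (Fin N),
      (∀ n, s.count n = (if a = n then 2 else 0) + (if b = n then 2 else 0)) →
      ∏ n, ∫ x, x ^ s.count n ∂(gaussianReal 0 1) = 1 := by
    intro a b hab s hs
    refine Finset.prod_eq_one fun n _ => ?_
    rw [hs]
    by_cases ha : a = n
    · have hb : b ≠ n := fun hb => hab (ha.trans hb.symm)
      simp [ha, hb, m2]
    · by_cases hb : b = n <;> simp [ha, hb, m2]
  by_cases hij : i = j
  · subst hij
    by_cases hkl : k = l
    · subst hkl
      by_cases hik : i = k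
      · subst hik
        rw [Finset.prod_eq_single i]
        · simp [m4]
          norm_num
        · intro n _ hn
          simp [Ne.symm hn]
        · simp
      · rw [hpair i k hik]
        · simp [hik]
        · intro n
          simp only [List.count_cons, List.count_nil, beq_iff_eq]
          split_ifs <;> rfl
    · have hz : ∏ n, ∫ x, x ^ [i, i, k, l].count n ∂(gaussianReal 0 1) = 0 := by
        refine Finset.prod_eq_zero (Finset.mem_univ k) ?_
        by_cases hik : i = k
        · simpa [List.count_cons, hik, Ne.symm hkl] using m3
        · simp [hik, Ne.symm hkl]
      rw [hz]
      by_cases hik : i = k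
      · subst hik; simp [hkl]
      · simp [hik, hkl]
  · by_cases hik : i = k
    · subst hik
      by_cases hjl : j = l
      · subst hjl
        rw [hpair i j hij]
        · simp [hij]
        · intro n
          simp only [List.count_cons, List.count_nil, beq_iff_eq]
          split_ifs <;> rfl
      · rw [Finset.prod_eq_zero (Finset.mem_univ j)]
        · simp [hij, hjl, Ne.symm hij]
        · simp [hij, Ne.symm hjl]
    · by_cases hil : i = l
      · subst hil
        by_cases hjk : j = k
        · subst hjk
          rw [hpair i j hij]
          · simp [hij]
          · intro n
            simp only [List.count_cons, List.count_nil, beq_iff_eq]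
            split_ifs <;> rfl
        · rw [Finset.prod_eq_zero (Finset.mem_univ j)]
          · simp [hij, hik, hjk]
          · simp [hij, Ne.symm hjk]
      · rw [Finset.prod_eq_zero (Finset.mem_univ i)]
        · simp [hij, hik, hil]
        · simp [Ne.symm hij, Ne.symm hik, Ne.symm hil]

lemma integrable_one_stdGaussPi (N : ℕ) : Integrable (fun _ => (1 : ℝ)) (stdGaussPi N) := by
  simpa using integrable_prod_map ([] : List (Fin N))

lemma integrable_coord {N : ℕ} (i : Fin N) : Integrable (fun z => z i) (stdGaussPi N) := by
  simpa using integrable_prod_map [i]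

lemma integrable_coord_mul₂ {N : ℕ} (i j : Fin N) :
    Integrable (fun z => z i * z j) (stdGaussPi N) := by
  simpa using integrable_prod_map [i, j]

lemma integrable_coord_mul₃ {N : ℕ} (i j k : Fin N) :
    Integrable (fun z => z i * (z j * z k)) (stdGaussPi N) := by
  simpa using integrable_prod_map [i, j, k]

lemma integrable_coord_mul₄ {N : ℕ} (i j k l : Fin N) :
    Integrable (fun z => z i * z j * (z k * z l)) (stdGaussPi N) := by
  simpa [mul_assoc] using integrable_prod_map [i, j, k, l]

/-- The quadratic polynomial `½ zᵀAz + bᵀz + c`. -/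
def quadPoly {N : ℕ} (A : Matrix (Fin N) (Fin N) ℝ) (b : Fin N → ℝ) (c : ℝ) (z : Fin N → ℝ) : ℝ :=
  (1 / 2) * (∑ i, ∑ j, A i j * (z i * z j)) + (∑ i, b i * z i) + c

lemma mul_quadPoly {N : ℕ} (A : Matrix (Fin N) (Fin N) ℝ) (b : Fin N → ℝ) (c : ℝ)
    (h : (Fin N → ℝ) → ℝ) (z : Fin N → ℝ) :
    h z * quadPoly A b c z = (1 / 2) * (∑ i, ∑ j, A i j * (h z * (z i * z j))) +
      (∑ i, b i * (h z * z i)) + c * h z := by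
  simp only [quadPoly, mul_add, Finset.mul_sum]
  congr 1
  · congr 1
    · exact Finset.sum_congr rfl fun i _ => Finset.sum_congr rfl fun j _ => by ring
    · exact Finset.sum_congr rfl fun i _ => by ring
  · ring

lemma integrable_mul_quadPoly {N : ℕ} (A : Matrix (Fin N) (Fin N) ℝ) (b : Fin N → ℝ) (c : ℝ)
    {h : (Fin N → ℝ) → ℝ} (h₀ : Integrable h (stdGaussPi N))
    (h₁ : ∀ i, Integrable (fun z => h z * z i) (stdGaussPi N))
    (h₂ : ∀ i j, Integrable (fun z => h z * (z i * z j)) (stdGaussPi N)) :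
    Integrable (fun z => h z * quadPoly A b c z) (stdGaussPi N) := by
  simp only [mul_quadPoly]
  exact (((integrable_finsetSum _ fun i _ => integrable_finsetSum _ fun j _ =>
    (h₂ i j).const_mul (A i j)).const_mul (1 / 2)).add
      (integrable_finsetSum _ fun i _ => (h₁ i).const_mul (b i))).add (h₀.const_mul c)

lemma integral_mul_quadPoly {N : ℕ} (A : Matrix (Fin N) (Fin N) ℝ) (b : Fin N → ℝ) (c : ℝ)
    {h : (Fin N → ℝ) → ℝ} (h₀ : Integrable h (stdGaussPi N))
    (h₁ : ∀ i, Integrable (fun z => h z * z i) (stdGaussPi N))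
    (h₂ : ∀ i j, Integrable (fun z => h z * (z i * z j)) (stdGaussPi N)) :
    ∫ z, h z * quadPoly A b c z ∂(stdGaussPi N) =
      (1 / 2) * (∑ i, ∑ j, A i j * ∫ z, h z * (z i * z j) ∂(stdGaussPi N)) +
        (∑ i, b i * ∫ z, h z * z i ∂(stdGaussPi N)) + c * ∫ z, h z ∂(stdGaussPi N) := by
  have i₂ : ∀ i, Integrable (fun z => ∑ j, A i j * (h z * (z i * z j))) (stdGaussPi N) :=
    fun i => integrable_finsetSum _ fun j _ => (h₂ i j).const_mul (A i j)
  have i₂' := (integrable_finsetSum Finset.univ fun i _ => i₂ i).const_mul (1 / 2 : ℝ)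
  have i₁ := integrable_finsetSum Finset.univ fun i _ => (h₁ i).const_mul (b i)
  have i₁₂ : Integrable (fun z => (1 / 2) * (∑ i, ∑ j, A i j * (h z * (z i * z j))) +
      ∑ i, b i * (h z * z i)) (stdGaussPi N) := i₂'.add i₁
  simp only [mul_quadPoly]
  rw [integral_add i₁₂ (h₀.const_mul c), integral_add i₂' i₁, integral_const_mul,
    integral_const_mul, integral_finsetSum _ fun i _ => i₂ i,
    integral_finsetSum _ fun i _ => (h₁ i).const_mul (b i)]
  simp only [integral_const_mul]
  congr 3
  refine Finset.sum_congr rfl fun i _ => ?_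
  rw [integral_finsetSum _ fun j _ => (h₂ i j).const_mul (A i j)]
  simp only [integral_const_mul]

lemma integrable_quadPoly {N : ℕ} (A : Matrix (Fin N) (Fin N) ℝ) (b : Fin N → ℝ) (c : ℝ) :
    Integrable (quadPoly A b c) (stdGaussPi N) := by
  simpa using integrable_mul_quadPoly A b c (integrable_one_stdGaussPi N)
    (by simpa using integrable_coord) (by simpa using integrable_coord_mul₂)

lemma integral_quadPoly {N : ℕ} (A : Matrix (Fin N) (Fin N) ℝ) (b : Fin N → ℝ) (c : ℝ) :
    ∫ z, quadPoly A b c z ∂(stdGaussPi N) = (1 / 2) * A.trace + c := by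
  have h := integral_mul_quadPoly A b c (integrable_one_stdGaussPi N)
    (by simpa using integrable_coord) (by simpa using integrable_coord_mul₂)
  simp only [one_mul] at h
  rw [h, integral_one_stdGaussPi]
  simp [integral_coord, integral_coord_mul₂, Matrix.trace]

lemma integral_coord_mul_quadPoly {N : ℕ} (A : Matrix (Fin N) (Fin N) ℝ) (b : Fin N → ℝ) (c : ℝ)
    (k : Fin N) : ∫ z, z k * quadPoly A b c z ∂(stdGaussPi N) = b k := by
  rw [integral_mul_quadPoly A b c (integrable_coord k) (integrable_coord_mul₂ k)
    (integrable_coord_mul₃ k)]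
  simp [integral_coord, integral_coord_mul₂, integral_coord_mul₃]

lemma integral_coord_mul_coord_mul_quadPoly {N : ℕ} {A : Matrix (Fin N) (Fin N) ℝ}
    (hA : A.IsSymm) (b : Fin N → ℝ) (c : ℝ) (k l : Fin N) :
    ∫ z, z k * z l * quadPoly A b c z ∂(stdGaussPi N) =
      A k l + (if k = l then 1 else 0) * ∫ z, quadPoly A b c z ∂(stdGaussPi N) := by
  rw [integral_mul_quadPoly A b c (integrable_coord_mul₂ k l)
    (by simpa only [mul_assoc] using integrable_coord_mul₃ k l) (integrable_coord_mul₄ k l),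
    integral_quadPoly]
  simp only [mul_assoc (_ : ℝ) _ (_ : ℝ), integral_coord_mul₃, integral_coord_mul₂]
  simp only [← mul_assoc]
  have h4 : ∀ i j, ∫ z, z k * z l * z i * z j ∂(stdGaussPi N) = _ := fun i j => by
    simpa only [← mul_assoc] using integral_coord_mul₄ k l i j
  simp only [h4, mul_add, Finset.sum_add_distrib]
  have hlk : A l k = A k l := hA.apply k l
  by_cases hkl : k = l
  · subst hkl
    simp [Matrix.trace]
    ring
  · simp [hkl, hlk]
    ring

lemma integral_quadPoly_mul_self {N : ℕ} {A : Matrix (Fin N) (Fin N) ℝ}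
    (hA : A.IsSymm) (b : Fin N → ℝ) (c : ℝ) :
    ∫ z, quadPoly A b c z * quadPoly A b c z ∂(stdGaussPi N) -
      (∫ z, quadPoly A b c z ∂(stdGaussPi N)) * (∫ z, quadPoly A b c z ∂(stdGaussPi N)) =
      b ⬝ᵥ b + (1 / 2) * (A * A).trace := by
  have h₁ : ∀ i, Integrable (fun z => quadPoly A b c z * z i) (stdGaussPi N) := fun i => by
    simpa only [mul_comm] using integrable_mul_quadPoly A b c (integrable_coord i)
      (integrable_coord_mul₂ i) (integrable_coord_mul₃ i)
  have h₂ : ∀ i j, Integrable (fun z => quadPoly A b c z * (z i * z j)) (stdGaussPi N) :=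
    fun i j => by
      refine (integrable_mul_quadPoly A b c (integrable_coord_mul₂ i j) ?_
        (integrable_coord_mul₄ i j)).congr (ae_of_all _ fun z => mul_comm _ _)
      simpa only [mul_assoc] using integrable_coord_mul₃ i j
  rw [integral_mul_quadPoly A b c (integrable_quadPoly A b c) h₁ h₂]
  simp only [mul_comm (quadPoly A b c _), integral_coord_mul_quadPoly,
    integral_coord_mul_coord_mul_quadPoly hA, mul_add, Finset.sum_add_distrib]
  have htr : (A * A).trace = ∑ i, ∑ j, A i j * A i j := by
    simp only [Matrix.trace, Matrix.diag, Matrix.mul_apply]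
    exact Finset.sum_congr rfl fun i _ => Finset.sum_congr rfl fun j _ => by rw [hA.apply i j]
  have hdiag : ∑ i, ∑ j, A i j * ((if i = j then 1 else 0) *
      ∫ z, quadPoly A b c z ∂(stdGaussPi N)) = A.trace * ∫ z, quadPoly A b c z ∂(stdGaussPi N) := by
    simp [Matrix.trace, Finset.sum_mul]
  rw [hdiag, htr, integral_quadPoly, dotProduct]
  ring

lemma bip_gaussPi_of_log_eq_neg {N : ℕ} {μ : Fin N → ℝ} {L : Matrix (Fin N) (Fin N) ℝ}
    (hL : IsUnit L.det) {p q f h : (Fin N → ℝ) → ℝ}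
    (hp : ∀ z, Real.log (p (μ + L.mulVec z)) = -f z)
    (hq : ∀ z, Real.log (q (μ + L.mulVec z)) = -h z) :
    bip (gaussPi N μ (L * Lᵀ)) p q = ∫ z, f z * h z ∂(stdGaussPi N) -
      (∫ z, f z ∂(stdGaussPi N)) * ∫ z, h z ∂(stdGaussPi N) := by
  simp only [bip, integral_gaussPi_s19 μ L hL, hp, hq, integral_neg, neg_mul_neg]

lemma isUnit_gram_of_duplication {N M : ℕ} (hM : M = N * (N + 1) / 2)
    {vech : Matrix (Fin N) (Fin N) ℝ → Fin M → ℝ} {D : Matrix (Fin N × Fin N) (Fin M) ℝ}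
    (hD : ∀ A : Matrix (Fin N) (Fin N) ℝ, A.IsSymm →
      ∀ ij : Fin N × Fin N, (D.mulVec (vech A)) ij = A ij.1 ij.2) :
    IsUnit (Dᵀ * D).det := by
  let S : (Sym2 (Fin N) → ℝ) →ₗ[ℝ] (Fin N × Fin N → ℝ) :=
    LinearMap.funLeft ℝ ℝ fun p : Fin N × Fin N => s(p.1, p.2)
  have hS : Function.Injective S := by
    refine LinearMap.funLeft_injective_of_surjective ℝ ℝ _ fun s => ?_
    induction s with | _ i j => exact ⟨(i, j), rfl⟩
  have hrange : LinearMap.range S ≤ LinearMap.range D.mulVecLin := by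
    rintro _ ⟨u, rfl⟩
    refine ⟨vech (Matrix.of fun i j => u s(i, j)), funext fun p => ?_⟩
    rw [mulVecLin_apply, hD _ (by ext i j; simp [Sym2.eq_swap])]
    rfl
  have hcard : Module.finrank ℝ (LinearMap.range S) = M := by
    rw [LinearMap.finrank_range_of_inj hS, Module.finrank_fintype_fun_eq_card, Sym2.card,
      Fintype.card_fin, Nat.choose_two_right, hM, Nat.add_sub_cancel, mul_comm]
  have hrank : M ≤ (Dᵀ * D).rank := by
    rw [rank_transpose_mul_self]
    exact hcard.symm.le.trans (Submodule.finrank_mono hrange)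
  have hfull : (Dᵀ * D).rank = Fintype.card (Fin M) :=
    le_antisymm (rank_le_card_width _) (by simpa using hrank)
  rw [← isUnit_iff_isUnit_det, ← mulVec_surjective_iff_isUnit, ← coe_mulVecLin,
    ← LinearMap.range_eq_top]
  exact Submodule.eq_top_of_finrank_eq (by simpa [Matrix.rank] using hfull)

lemma vech_eq_pinv_mulVec {N M : ℕ} (hM : M = N * (N + 1) / 2)
    {vech : Matrix (Fin N) (Fin N) ℝ → Fin M → ℝ} {D : Matrix (Fin N × Fin N) (Fin M) ℝ}
    (hD : ∀ A : Matrix (Fin N) (Fin N) ℝ, A.IsSymm →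
      ∀ ij : Fin N × Fin N, (D.mulVec (vech A)) ij = A ij.1 ij.2)
    {A : Matrix (Fin N) (Fin N) ℝ} (hA : A.IsSymm) :
    vech A = ((Dᵀ * D)⁻¹ * Dᵀ).mulVec fun ij => A ij.1 ij.2 := by
  rw [← funext (hD A hA), mulVec_mulVec, Matrix.mul_assoc,
    nonsing_inv_mul _ (isUnit_gram_of_duplication hM hD), one_mulVec]

lemma half_quadForm_affine {N : ℕ} {Q : Matrix (Fin N) (Fin N) ℝ} (hQ : Q.IsSymm)
    (L : Matrix (Fin N) (Fin N) ℝ) (d z : Fin N → ℝ) :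
    (1 / 2) * ((L.mulVec z + d) ⬝ᵥ Q.mulVec (L.mulVec z + d)) =
      quadPoly (Lᵀ * Q * L) (Lᵀ.mulVec (Q.mulVec d)) ((1 / 2) * (d ⬝ᵥ Q.mulVec d)) z := by
  have h1 : ∑ i, ∑ j, (Lᵀ * Q * L) i j * (z i * z j) = L.mulVec z ⬝ᵥ Q.mulVec (L.mulVec z) := by
    have : L.mulVec z ⬝ᵥ Q.mulVec (L.mulVec z) = z ⬝ᵥ (Lᵀ * Q * L).mulVec z := by
      rw [← mulVec_mulVec, ← mulVec_mulVec, dotProduct_mulVec z, vecMul_transpose]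
    rw [this]
    simp only [dotProduct, mulVec, Finset.mul_sum]
    exact Finset.sum_congr rfl fun i _ => Finset.sum_congr rfl fun j _ => by ring
  have h2 : ∑ i, (Lᵀ.mulVec (Q.mulVec d)) i * z i = L.mulVec z ⬝ᵥ Q.mulVec d := by
    rw [dotProduct_comm, dotProduct_mulVec, ← mulVec_transpose]
    rfl
  have h3 : d ⬝ᵥ Q.mulVec (L.mulVec z) = L.mulVec z ⬝ᵥ Q.mulVec d := by
    rw [dotProduct_mulVec, ← mulVec_transpose, hQ.eq, dotProduct_comm]
  rw [quadPoly, h1, h2, mulVec_add, dotProduct_add, add_dotProduct, add_dotProduct, h3]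
  ring

/-- **Coordinates and information of a Gaussian in Bayes space.**  With Gaussian measure
`ν = N(μ, Σ)`, `Σ = LLᵀ`, the Bayes-space projection of the indefinite Gaussian
`g = exp (-(1/2)(x−μ′)ᵀΣ′⁻¹(x−μ′))` onto the orthonormal indefinite-Gaussian basis has
coordinates `α₁ = LᵀΣ′⁻¹(μ−μ′)` and `α₂ = √((1/2)DᵀD)·D†·vec (LᵀΣ′⁻¹L)` (with `D` the
duplication matrix and `D† = (DᵀD)⁻¹Dᵀ` its Moore–Penrose pseudoinverse), and its information
`I(g) = (1/2)⟨g,g⟩` equals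
`(1/2)[(μ−μ′)ᵀΣ′⁻¹ΣΣ′⁻¹(μ−μ′) + (1/2)tr (Σ′⁻¹ΣΣ′⁻¹Σ)]`. -/
theorem gaussian_coordinates_and_information (N M : ℕ) (hM : M = N * (N + 1) / 2)
    (μ μ' : Fin N → ℝ) (L : Matrix (Fin N) (Fin N) ℝ) (hL : IsUnit L.det)
    (Sig : Matrix (Fin N) (Fin N) ℝ) (hSig : IsUnit Sig.det) (hSigs : Sig.IsSymm)
    (vech : Matrix (Fin N) (Fin N) ℝ → Fin M → ℝ)
    (D : Matrix (Fin N × Fin N) (Fin M) ℝ)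
    (hD : ∀ A : Matrix (Fin N) (Fin N) ℝ, A.IsSymm →
      ∀ ij : Fin N × Fin N, (D.mulVec (vech A)) ij = A ij.1 ij.2)
    (R : Matrix (Fin M) (Fin M) ℝ) (hR : R * R = (2⁻¹ : ℝ) • (Dᵀ * D)) (hRs : R.IsSymm) :
    (∀ i, bip (gaussPi N μ (L * Lᵀ)) (gOne N μ L i)
        (fun x => Real.exp (-(1 / 2) * ((x - μ') ⬝ᵥ Sig⁻¹.mulVec (x - μ')))) =
      (Lᵀ.mulVec (Sig⁻¹.mulVec (μ - μ'))) i) ∧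
    (∀ k, bip (gaussPi N μ (L * Lᵀ)) (gTwo N M μ L vech R k)
        (fun x => Real.exp (-(1 / 2) * ((x - μ') ⬝ᵥ Sig⁻¹.mulVec (x - μ')))) =
      (R.mulVec (((Dᵀ * D)⁻¹ * Dᵀ).mulVec
        (fun ij => (Lᵀ * Sig⁻¹ * L) ij.1 ij.2))) k) ∧
    ((1 / 2) * bip (gaussPi N μ (L * Lᵀ))
        (fun x => Real.exp (-(1 / 2) * ((x - μ') ⬝ᵥ Sig⁻¹.mulVec (x - μ'))))
        (fun x => Real.exp (-(1 / 2) * ((x - μ') ⬝ᵥ Sig⁻¹.mulVec (x - μ')))) =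
      (1 / 2) * ((μ - μ') ⬝ᵥ (Sig⁻¹ * (L * Lᵀ) * Sig⁻¹).mulVec (μ - μ') +
        (1 / 2) * (Sig⁻¹ * (L * Lᵀ) * Sig⁻¹ * (L * Lᵀ)).trace)) := by
  set Q := Sig⁻¹ with hQdef
  have hQ : Q.IsSymm := by
    rw [Matrix.IsSymm, hQdef, transpose_nonsing_inv, hSigs.eq]
  set A := Lᵀ * Q * L with hAdef
  have hA : A.IsSymm := by
    simp only [Matrix.IsSymm, hAdef, transpose_mul, transpose_transpose, hQ.eq, Matrix.mul_assoc]
  set b := Lᵀ.mulVec (Q.mulVec (μ - μ')) with hb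
  set c := (1 / 2) * ((μ - μ') ⬝ᵥ Q.mulVec (μ - μ')) with hc
  have hlog : ∀ z, Real.log (Real.exp (-(1 / 2) *
      ((μ + L.mulVec z - μ') ⬝ᵥ Q.mulVec (μ + L.mulVec z - μ')))) = -quadPoly A b c z := by
    intro z
    rw [Real.log_exp, ← half_quadForm_affine hQ L (μ - μ') z, add_sub_right_comm, add_comm (μ - μ')]
    ring
  have hinv : ∀ z, L⁻¹.mulVec (L.mulVec z) = z := fun z => by
    rw [mulVec_mulVec, nonsing_inv_mul _ hL, one_mulVec]
  refine ⟨fun i => ?_, fun k => ?_, ?_⟩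
  · have hlog₁ : ∀ z, Real.log (gOne N μ L i (μ + L.mulVec z)) = -z i := fun z => by
      rw [gOne, Real.log_exp, add_sub_cancel_left, hinv]
    rw [bip_gaussPi_of_log_eq_neg hL hlog₁ hlog, integral_coord_mul_quadPoly, integral_coord,
      zero_mul, sub_zero]
  · set W := R * ((Dᵀ * D)⁻¹ * Dᵀ) with hW
    have hlog₂ : ∀ z, Real.log (gTwo N M μ L vech R k (μ + L.mulVec z)) =
        -∑ p : Fin N × Fin N, W k p * (z p.1 * z p.2) := fun z => by
      rw [gTwo, Real.log_exp, add_sub_cancel_left, mul_vecMulVec, vecMulVec_mul, vecMul_transpose,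
        hinv, vech_eq_pinv_mulVec hM hD (transpose_vecMulVec z z), mulVec_mulVec]
      rfl
    have hint : ∀ p : Fin N × Fin N,
        Integrable (fun z => W k p * (z p.1 * z p.2)) (stdGaussPi N) := fun p =>
      (integrable_coord_mul₂ p.1 p.2).const_mul _
    have hint' : ∀ p : Fin N × Fin N, Integrable
        (fun z => W k p * (z p.1 * z p.2 * quadPoly A b c z)) (stdGaussPi N) := fun p =>
      (integrable_mul_quadPoly A b c (integrable_coord_mul₂ p.1 p.2)
        (by simpa only [mul_assoc] using integrable_coord_mul₃ p.1 p.2)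
        (integrable_coord_mul₄ p.1 p.2)).const_mul _
    rw [bip_gaussPi_of_log_eq_neg hL hlog₂ hlog]
    simp only [Finset.sum_mul, mul_assoc (W k _)]
    rw [integral_finsetSum _ fun p _ => hint' p, integral_finsetSum _ fun p _ => hint p,
      Finset.sum_mul, ← Finset.sum_sub_distrib, mulVec_mulVec]
    refine Finset.sum_congr rfl fun p _ => ?_
    rw [integral_const_mul, integral_const_mul, integral_coord_mul_coord_mul_quadPoly hA,
      integral_coord_mul₂]
    ring
  · rw [bip_gaussPi_of_log_eq_neg hL hlog hlog, integral_quadPoly_mul_self hA]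
    have hbb : b ⬝ᵥ b = (μ - μ') ⬝ᵥ (Q * (L * Lᵀ) * Q).mulVec (μ - μ') := by
      simp only [hb, ← mulVec_mulVec]
      rw [dotProduct_mulVec (μ - μ') Q, ← mulVec_transpose Q, hQ.eq, dotProduct_mulVec _ L,
        ← mulVec_transpose L]
    have htr : (A * A).trace = (Q * (L * Lᵀ) * Q * (L * Lᵀ)).trace := by
      rw [hAdef, Matrix.mul_assoc Lᵀ, Matrix.mul_assoc Lᵀ, trace_mul_comm]
      simp only [Matrix.mul_assoc]
    rw [hbb, htr]
end
end
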